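/- Let G = (V,E) be a strongly connected finite simple directed graph. Define the 2-directed block graph G^{2d} = (V^{2d}, E^{2d}) of G as the undirected bipartite graph whose vertices are, on one side, the 2-directed blocks of G and, on the other side, those vertices of G that lie in at least two distinct 2-directed blocks, with an undirected edge joining a block C and a vertex w whenever w ∈ C and w lies in at least two distinct 2-directed blocks. Then G^{2d} is a forest (it contains no cycle). -/

import Mathlib

variable {V : Type*}

/-- `p` is a simple directed path from `x` to `y` w.r.t. the edge relation `E`. -/
def IsDipath (E : V → V → Prop) (x y : V) (p : List V) : Prop :=
  List.Chain' E p ∧ p.head? = some x ∧ p.getLast? = some y ∧ p.Nodup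

/-- The edges of a path, as the list of consecutive pairs. -/
def dipathEdges (p : List V) : List (V × V) := p.zip p.tail

/-- There are two (distinct, internally vertex-disjoint) paths from `x` to `y`:
they share no vertices other than `x` and `y`. -/
def TwoVDP (E : V → V → Prop) (x y : V) : Prop :=
  ∃ p q : List V, IsDipath E x y p ∧ IsDipath E x y q ∧ p ≠ q ∧
    ∀ z, z ∈ p → z ∈ q → z = x ∨ z = y

/-- There are two edge-disjoint paths from `x` to `y`. -/
def TwoEDP (E : V → V → Prop) (x y : V) : Prop :=
  ∃ p q : List V, IsDipath E x y p ∧ IsDipath E x y q ∧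
    ∀ e, e ∈ dipathEdges p → e ∉ dipathEdges q

/-- Reachability in a digraph. -/
def DiReach (E : V → V → Prop) (x y : V) : Prop := Relation.ReflTransGen E x y

/-- `x` and `y` lie in the same strongly connected component. -/
def InSameSCC (E : V → V → Prop) (x y : V) : Prop := DiReach E x y ∧ DiReach E y x

/-- The digraph is strongly connected. -/
def IsStronglyConn (E : V → V → Prop) : Prop := ∀ x y, DiReach E x y

/-- Deleting a vertex `w` (and its incident edges). -/
def DelVertex (E : V → V → Prop) (w : V) : V → V → Prop :=
  fun a b => E a b ∧ a ≠ w ∧ b ≠ w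

/-- `x ↔² y` : two vertex-disjoint paths in both directions. -/
def Rel2d (E : V → V → Prop) (x y : V) : Prop :=
  x ≠ y ∧ TwoVDP E x y ∧ TwoVDP E y x

/-- `x ↔^{2s} y`. -/
def Rel2s (E : V → V → Prop) (x y : V) : Prop :=
  x ≠ y ∧ ∀ z, z ≠ x → z ≠ y → InSameSCC (DelVertex E z) x y

/-- `x ↔^{2e} y` : two edge-disjoint paths in both directions. -/
def Rel2e (E : V → V → Prop) (x y : V) : Prop :=
  x ≠ y ∧ TwoEDP E x y ∧ TwoEDP E y x

/-- A maximal vertex set of size ≥ `k` all of whose pairs of distinct elements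
satisfy the relation `R` (e.g. a 2-directed/2-strong/2-edge block). -/
def IsMaxBlock (R : V → V → Prop) (k : ℕ) (C : Set V) : Prop :=
  k ≤ C.ncard ∧ (∀ x ∈ C, ∀ y ∈ C, x ≠ y → R x y) ∧
    ∀ D : Set V, C ⊆ D → (∀ x ∈ D, ∀ y ∈ D, x ≠ y → R x y) → D = C

/-- The 2-directed block graph: an undirected bipartite graph whose vertices are the
2-directed blocks (left) and the vertices of `G` lying in at least two distinct
2-directed blocks (right), a block `C` being joined to a vertex `w` iff `w ∈ C` and
`w` lies in at least two distinct 2-directed blocks. -/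
def blockGraph (E : V → V → Prop) : SimpleGraph (Set V ⊕ V) :=
  SimpleGraph.fromRel (fun a b =>
    ∃ (C : Set V) (w : V), a = Sum.inl C ∧ b = Sum.inr w ∧
      IsMaxBlock (Rel2d E) 2 C ∧ w ∈ C ∧
      ∃ C' : Set V, IsMaxBlock (Rel2d E) 2 C' ∧ C' ≠ C ∧ w ∈ C')

theorem rtg_mono {r s : V → V → Prop} {x y : V} (hxy : Relation.ReflTransGen r x y)
    (h : ∀ a b, r a b → s a b) : Relation.ReflTransGen s x y := by
  induction hxy with
  | refl => exact .refl
  | tail _ hbc ih => exact ih.tail (h _ _ hbc)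

/-- Steps of `E` landing in `S`. -/
def StepIn (E : V → V → Prop) (S : Set V) : V → V → Prop := fun a b => E a b ∧ b ∈ S

theorem StepIn.mono_rtg {E : V → V → Prop} {S T : Set V} (h : S ⊆ T) {a b : V}
    (hab : Relation.ReflTransGen (StepIn E S) a b) : Relation.ReflTransGen (StepIn E T) a b :=
  rtg_mono hab fun _ _ hh => ⟨hh.1, h hh.2⟩

theorem exists_dipath {E : V → V → Prop} {x y : V} (h : Relation.ReflTransGen E x y) :
    ∃ p, IsDipath E x y p := by
  induction h using Relation.ReflTransGen.head_induction_on with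
  | refl => exact ⟨[y], List.isChain_singleton _, by simp, by simp, by simp⟩
  | @head a c hac _ ih =>
    obtain ⟨p, hp1, hp2, hp3, hp4⟩ := ih
    change List.IsChain E p at hp1
    by_cases ha : a ∈ p
    · obtain ⟨s, t, rfl⟩ := List.append_of_mem ha
      refine ⟨a :: t, List.IsChain.right_of_append hp1, by simp, ?_, ?_⟩
      · simpa using hp3
      · exact (List.nodup_append.1 hp4).2.1
    · cases p with
      | nil => simp at hp2
      | cons d p =>
        simp at hp2
        subst hp2
        refine ⟨a :: d :: p, ?_, by simp, ?_, ?_⟩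
        · exact List.isChain_cons_cons.2 ⟨hac, hp1⟩
        · simpa using hp3
        · exact List.nodup_cons.2 ⟨ha, hp4⟩

theorem IsDipath.mono {E F : V → V → Prop} (h : ∀ a b, E a b → F a b) {x y : V} {p : List V}
    (hp : IsDipath E x y p) : IsDipath F x y p :=
  ⟨List.IsChain.imp h hp.1, hp.2⟩

theorem chain_mem {E : V → V → Prop} {S : Set V} : ∀ (p : List V) (x : V), x ∈ S →
    (x :: p).IsChain (StepIn E S) → ∀ a ∈ x :: p, a ∈ S
  | [], x, hx, _, a, ha => by simp at ha; exact ha ▸ hx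
  | b :: p, x, hx, hc, a, ha => by
    rw [List.isChain_cons_cons] at hc
    rcases List.mem_cons.1 ha with rfl | ha
    · exact hx
    · exact chain_mem p b hc.1.2 hc.2 a ha

theorem exists_dipath_in {E : V → V → Prop} {S : Set V} {x y : V} (hx : x ∈ S)
    (h : Relation.ReflTransGen (StepIn E S) x y) :
    ∃ p, IsDipath E x y p ∧ ∀ a ∈ p, a ∈ S := by
  obtain ⟨p, hp⟩ := exists_dipath h
  refine ⟨p, hp.mono fun a b h => h.1, ?_⟩
  cases p with
  | nil => intro a ha; simp at ha
  | cons b p =>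
    have := hp.2.1
    simp at this
    subst this
    exact chain_mem p b hx hp.1

theorem chain_reach {E : V → V → Prop} {S : Set V} : ∀ (p : List V) (x : V),
    (∀ a ∈ x :: p, a ∈ S) → (x :: p).IsChain E →
    ∀ a ∈ x :: p, Relation.ReflTransGen (StepIn E S) x a
  | [], x, _, _, a, ha => by simp at ha; rw [ha]
  | b :: p, x, hS, hc, a, ha => by
    rw [List.isChain_cons_cons] at hc
    rcases List.mem_cons.1 ha with rfl | ha
    · exact .refl
    · exact .head ⟨hc.1, hS b (by simp)⟩
        (chain_reach p b (fun c hc => hS c (List.mem_cons_of_mem _ hc)) hc.2 a ha)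

theorem chain_pred {E : V → V → Prop} {m : V} {L : List V} : ∀ (M : List V) (v : V),
    (v :: (M ++ m :: L)).IsChain E → ∃ c ∈ v :: M, E c m
  | [], v, h => by
    simp only [List.nil_append, List.isChain_cons_cons] at h
    exact ⟨v, by simp, h.1⟩
  | b :: M, v, h => by
    simp only [List.cons_append, List.isChain_cons_cons] at h
    obtain ⟨c, hc, hcm⟩ := chain_pred M b h.2
    exact ⟨c, List.mem_cons_of_mem _ hc, hcm⟩

theorem crossing {r : V → V → Prop} {S T : Set V} (hST : ∀ a ∈ S, a ∉ T) {x y : V}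
    (hx : x ∈ S) (hy : y ∈ T) (h : Relation.ReflTransGen r x y) :
    ∃ q ∈ S, ∃ s, ∃ m ∈ T,
      Relation.ReflTransGen (fun a b => r a b ∧ b ∉ S ∧ b ∉ T) q s ∧ r s m := by
  by_contra hcon
  have key : ∀ z, Relation.ReflTransGen r x z →
      ∃ q ∈ S, Relation.ReflTransGen (fun a b => r a b ∧ b ∉ S ∧ b ∉ T) q z := by
    intro z hz
    induction hz with
    | refl => exact ⟨x, hx, .refl⟩
    | @tail b c _ hbc ih =>
      obtain ⟨q, hq, hqb⟩ := ih
      by_cases hcT : c ∈ T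
      · exact absurd ⟨q, hq, b, c, hcT, hqb, hbc⟩ hcon
      by_cases hcS : c ∈ S
      · exact ⟨c, hcS, .refl⟩
      · exact ⟨q, hq, hqb.tail ⟨hbc, hcS, hcT⟩⟩
  obtain ⟨q, hq, hqy⟩ := key y h
  rcases Relation.ReflTransGen.cases_tail hqy with h | ⟨c, _, h⟩
  · exact hST q hq (h ▸ hy)
  · exact h.2.2 hy

/-- Two rooted sets at `x`, meeting only in `x`, both with an edge into `v`. -/
structure Fan (E : V → V → Prop) (x v : V) (A B : Set V) : Prop where
  xA : x ∈ A
  xB : x ∈ B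
  disj : ∀ a ∈ A, a ∈ B → a = x
  rA : ∀ a ∈ A, Relation.ReflTransGen (StepIn E A) x a
  rB : ∀ a ∈ B, Relation.ReflTransGen (StepIn E B) x a
  vA : v ∉ A
  vB : v ∉ B
  eA : ∃ a ∈ A, E a v
  eB : ∃ a ∈ B, E a v

theorem Fan.symm {E : V → V → Prop} {x v : V} {A B : Set V} (h : Fan E x v A B) :
    Fan E x v B A :=
  ⟨h.xB, h.xA, fun a ha hb => h.disj a hb ha, h.rB, h.rA, h.vB, h.vA, h.eB, h.eA⟩

/-- Extend a fan: the new path leaves `A`. -/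
theorem Fan.step {E : V → V → Prop} {x v : V} {A B : Set V} (h : Fan E x v A B)
    {M L : List V} {m : V} (hL : ∀ a ∈ M ++ m :: L, a ∉ A ∧ a ∉ B)
    (hc : (v :: (M ++ m :: L)).IsChain E) (hn : (v :: (M ++ m :: L)).Nodup)
    {q s : V} (hq : q ∈ A)
    (hqs : Relation.ReflTransGen (fun a b => DelVertex E v a b ∧ b ∉ A ∪ B ∧
      b ∉ {a | a ∈ M ++ m :: L}) q s) (hsm : E s m) :
    ∃ A' B', Fan E x m A' B' ∧ ∀ a ∈ L, a ∉ A' ∧ a ∉ B' := by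
  set r := (fun a b => DelVertex E v a b ∧ b ∉ A ∪ B ∧ b ∉ {a | a ∈ M ++ m :: L}) with hr
  let N : Set V := {t | Relation.ReflTransGen r q t}
  have hN : ∀ t ∈ N, t = q ∨ (t ≠ v ∧ t ∉ A ∧ t ∉ B ∧ t ∉ M ++ m :: L) := by
    intro t ht
    rcases Relation.ReflTransGen.cases_tail ht with h | ⟨c, _, h⟩
    · exact .inl h
    · right
      refine ⟨h.1.2.2, fun h' => h.2.1 (.inl h'), fun h' => h.2.1 (.inr h'), h.2.2⟩
  have hNr : ∀ t ∈ N, Relation.ReflTransGen (StepIn E (A ∪ N)) q t := by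
    intro t ht
    have ht' : Relation.ReflTransGen r q t := ht
    induction ht' with
    | refl => exact .refl
    | @tail b c hb hbc ih => exact (ih hb).tail ⟨hbc.1.1, .inr ht⟩
  have hcM : (v :: M).IsChain E := by
    have : (v :: M) ++ (m :: L) = v :: (M ++ m :: L) := rfl
    rw [← this] at hc
    exact hc.left_of_append
  obtain ⟨c, hcM', hcm⟩ := chain_pred M v hc
  have hmv : ∀ a ∈ m :: L, a ≠ v ∧ a ∉ M := by
    have hn' : ((v :: M) ++ (m :: L)).Nodup := hn
    have := (List.nodup_append.1 hn').2.2
    intro a ha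
    refine ⟨fun h' => this v (by simp) a ha h'.symm, fun h' => this a (by simp [h']) a ha rfl⟩
  have hmL : ∀ a ∈ m :: L, a ∉ A ∧ a ∉ B := fun a ha => hL a (List.mem_append_right _ ha)
  have hA' : ∀ a ∈ m :: L, a ∉ B ∪ {a | a ∈ v :: M} := by
    intro a ha h'
    rcases h' with h' | h'
    · exact (hmL a ha).2 h'
    · rcases List.mem_cons.1 h' with h' | h'
      · exact (hmv a ha).1 h'
      · exact (hmv a ha).2 h'
  have hB' : ∀ a ∈ m :: L, a ∉ A ∪ N := by
    intro a ha h'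
    rcases h' with h' | h'
    · exact (hmL a ha).1 h'
    · rcases hN a h' with h' | h'
      · exact (hmL a ha).1 (h' ▸ hq)
      · exact h'.2.2.2 (List.mem_append_right _ ha)
  refine ⟨B ∪ {a | a ∈ v :: M}, A ∪ N, ⟨.inl h.xB, .inl h.xA, ?_, ?_, ?_, hA' m (by simp),
    hB' m (by simp), ⟨c, .inr hcM', hcm⟩, ⟨s, .inr hqs, hsm⟩⟩,
    fun a ha => ⟨hA' a (List.mem_cons_of_mem _ ha), hB' a (List.mem_cons_of_mem _ ha)⟩⟩
  · intro a ha hb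
    have hvM : a ∈ v :: M → a ∉ A := by
      intro h'
      rcases List.mem_cons.1 h' with h' | h'
      · exact h' ▸ h.vA
      · exact (hL a (List.mem_append_left _ h')).1
    have hbq : a ∈ A → a = x := by
      intro h2
      rcases ha with ha | ha
      · exact h.disj a h2 ha
      · exact absurd h2 (hvM ha)
    rcases hb with hb | hb
    · exact hbq hb
    · rcases hN a hb with hb | hb
      · exact hbq (hb ▸ hq)
      · exfalso
        rcases ha with ha | ha
        · exact hb.2.2.1 ha
        · rcases List.mem_cons.1 ha with h' | h'
          · exact hb.1 h'
          · exact hb.2.2.2 (List.mem_append_left _ h')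
  · intro a ha
    rcases ha with ha | ha
    · exact StepIn.mono_rtg Set.subset_union_left (h.rB a ha)
    · obtain ⟨b, hb, hbv⟩ := h.eB
      refine ((StepIn.mono_rtg Set.subset_union_left (h.rB b hb)).tail
        ⟨hbv, .inr (by simp)⟩).trans ?_
      exact chain_reach M v (fun a ha => .inr ha) hcM a ha
  · intro a ha
    rcases ha with ha | ha
    · exact StepIn.mono_rtg Set.subset_union_left (h.rA a ha)
    · exact (StepIn.mono_rtg Set.subset_union_left (h.rA q hq)).trans (hNr a ha)

theorem Fan.reach {E : V → V → Prop} {x y : V}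
    (hcut : ∀ z, z ≠ x → z ≠ y → Relation.ReflTransGen (DelVertex E z) x y) :
    ∀ (n : ℕ) (L : List V) (v : V) (A B : Set V), L.length ≤ n → Fan E x v A B →
      (∀ a ∈ L, a ∉ A ∧ a ∉ B) → (v :: L).IsChain E → (v :: L).Nodup →
      (v :: L).getLast? = some y → ∃ A' B', Fan E x y A' B' := by
  intro n
  induction n with
  | zero =>
    intro L v A B hl hF _ _ _ hy
    have : L = [] := by simpa using hl
    subst this
    simp at hy
    exact ⟨A, B, hy ▸ hF⟩
  | succ n ih =>
    intro L v A B hl hF hL hc hn hy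
    by_cases hvy : v = y
    · exact ⟨A, B, hvy ▸ hF⟩
    have hyL : y ∈ L := by
      have := List.mem_of_getLast? hy
      rcases List.mem_cons.1 this with h | h
      · exact absurd h.symm hvy
      · exact h
    have hvx : v ≠ x := fun h => hF.vA (h ▸ hF.xA)
    obtain ⟨q, hq, s, m, hm, hqs, hsm⟩ := crossing (S := A ∪ B) (T := {a | a ∈ L})
      (by
        rintro a (ha | ha) ha'
        · exact (hL a ha').1 ha
        · exact (hL a ha').2 ha) (.inl hF.xA) hyL (hcut v hvx hvy)
    obtain ⟨M, L', rfl⟩ := List.append_of_mem (show m ∈ L from hm)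
    have : ∃ A' B', Fan E x m A' B' ∧ ∀ a ∈ L', a ∉ A' ∧ a ∉ B' := by
      rcases hq with hq | hq
      · exact hF.step hL hc hn hq hqs hsm.1
      · rw [Set.union_comm] at hqs
        exact hF.symm.step (fun a ha => (hL a ha).symm) hc hn hq hqs hsm.1
    obtain ⟨A', B', hF', hL'⟩ := this
    have e : v :: (M ++ m :: L') = (v :: M) ++ (m :: L') := rfl
    rw [e] at hc hn hy
    refine ih L' m A' B' ?_ hF' hL' hc.right_of_append (List.nodup_append.1 hn).2.1 ?_
    · simp at hl; omega
    · rw [List.getLast?_append] at hy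
      simpa using hy

theorem twoVDP_of_cut {E : V → V → Prop} {x y : V} (hxy : x ≠ y)
    (hcut : ∀ z, z ≠ x → z ≠ y → Relation.ReflTransGen (DelVertex E z) x y)
    (hedge : Relation.ReflTransGen (fun a b => E a b ∧ ¬ (a = x ∧ b = y)) x y) :
    TwoVDP E x y := by
  obtain ⟨p, hp⟩ := exists_dipath hedge
  have hpE : IsDipath E x y p := hp.mono fun a b h => h.1
  by_cases hE : E x y
  · refine ⟨[x, y], p, ⟨?_, by simp, by simp, by simp [hxy]⟩, hpE, ?_, ?_⟩
    · exact List.isChain_pair.2 hE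
    · rintro rfl
      exact (List.isChain_pair.1 hp.1).2 ⟨rfl, rfl⟩
    · intro z hz _
      simpa using hz
  · obtain ⟨hc, hh, hl, hn⟩ := hpE
    match p, hc, hh, hl, hn with
    | [], _, hh, _, _ => simp at hh
    | [a], _, hh, hl, _ => simp at hh hl; exact absurd (hh.symm.trans hl) hxy
    | a :: v :: L, hc, hh, hl, hn =>
      simp at hh
      subst hh
      have hc' := List.isChain_cons_cons.1 hc
      rw [List.nodup_cons] at hn
      have hF : Fan E a v {a} {a} := by
        refine ⟨rfl, rfl, fun b hb _ => hb, ?_, ?_, ?_, ?_, ⟨a, rfl, hc'.1⟩, ⟨a, rfl, hc'.1⟩⟩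
        · rintro b rfl; exact .refl
        · rintro b rfl; exact .refl
        · rintro rfl; exact hn.1 (by simp)
        · rintro rfl; exact hn.1 (by simp)
      obtain ⟨A, B, hAB⟩ := Fan.reach hcut L.length L v {a} {a} le_rfl hF
        (by
          intro b hb
          have : b ≠ a := by rintro rfl; exact hn.1 (by simp [hb])
          exact ⟨this, this⟩) hc'.2 hn.2 (by simpa using hl)
      have get : ∀ A : Set V, a ∈ A → (∀ b ∈ A, Relation.ReflTransGen (StepIn E A) a b) →
          (∃ b ∈ A, E b y) → ∃ p, IsDipath E a y p ∧ ∀ c ∈ p, c ∈ insert y A := by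
        rintro A ha hr ⟨b, hb, hby⟩
        refine exists_dipath_in (.inr ha) ?_
        exact (StepIn.mono_rtg (Set.subset_insert _ _) (hr b hb)).tail ⟨hby, .inl rfl⟩
      obtain ⟨p, hp, hpA⟩ := get A hAB.xA hAB.rA hAB.eA
      obtain ⟨q, hq, hqB⟩ := get B hAB.xB hAB.rB hAB.eB
      have hd : ∀ z, z ∈ p → z ∈ q → z = a ∨ z = y := by
        intro z h1 h2
        rcases hpA z h1 with h1 | h1
        · exact .inr h1
        rcases hqB z h2 with h2 | h2
        · exact .inr h2
        exact .inl (hAB.disj z h1 h2)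
      refine ⟨p, q, hp, hq, ?_, hd⟩
      rintro rfl
      obtain ⟨hc2, hh2, hl2, hn2⟩ := hp
      have hd2 := hd
      clear hd hq hpA hqB
      match p, hc2, hh2, hl2, hn2, hd2 with
      | [], _, hh2, _, _, _ => simp at hh2
      | [a], _, hh2, hl2, _, _ => simp at hh2 hl2; exact absurd (hh2.symm.trans hl2) hxy
      | a :: u :: K, hc2, hh2, hl2, hn2, hd2 =>
        simp at hh2
        subst hh2
        rcases hd2 u (by simp) (by simp) with h | h
        · subst h; simp at hn2
        · subst h; exact hE (List.isChain_cons_cons.1 hc2).1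

theorem IsDipath.rtg {E : V → V → Prop} {x y : V} {p : List V} (hp : IsDipath E x y p) :
    Relation.ReflTransGen E x y := by
  obtain ⟨hc, hh, hl, -⟩ := hp
  cases p with
  | nil => simp at hh
  | cons a p =>
    simp at hh
    subst hh
    have := chain_reach (S := Set.univ) p a (fun _ _ => trivial) hc y (List.mem_of_getLast? hl)
    exact rtg_mono this fun _ _ h => h.1

theorem IsDipath.rtg_del {E : V → V → Prop} {x y z : V} {p : List V} (hp : IsDipath E x y p)
    (hz : z ∉ p) : Relation.ReflTransGen (DelVertex E z) x y := by
  refine IsDipath.rtg (p := p) ⟨?_, hp.2⟩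
  refine List.IsChain.imp_of_mem_imp ?_ hp.1
  intro a b ha hb h
  exact ⟨h, fun h' => hz (h' ▸ ha), fun h' => hz (h' ▸ hb)⟩

theorem IsDipath.rtg_edge {E : V → V → Prop} {x y : V} {p : List V} (hp : IsDipath E x y p)
    (hxy : x ≠ y) (hne : p ≠ [x, y]) :
    Relation.ReflTransGen (fun a b => E a b ∧ ¬ (a = x ∧ b = y) ∧ ¬ (a = y ∧ b = x)) x y := by
  obtain ⟨hc, hh, hl, hn⟩ := hp
  match p, hc, hh, hl, hn, hne with
  | [], _, hh, _, _, _ => simp at hh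
  | [a], _, hh, hl, _, _ => simp at hh hl; exact absurd (hh.symm.trans hl) hxy
  | a :: v :: L, hc, hh, hl, hn, hne =>
    simp at hh
    subst hh
    have hc' := List.isChain_cons_cons.1 hc
    rw [List.nodup_cons] at hn
    have hva : v ≠ a := by rintro rfl; exact hn.1 (by simp)
    have hvy : v ≠ y := by
      rintro rfl
      cases L with
      | nil => exact hne rfl
      | cons b L =>
        have : v ∈ b :: L := List.mem_of_getLast? (by simpa using hl)
        exact (List.nodup_cons.1 hn.2).1 this
    have hd : IsDipath E v y (v :: L) := ⟨hc'.2, rfl, by simpa using hl, hn.2⟩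
    refine .head ⟨hc'.1, fun h => hvy h.2, fun h => hva h.2⟩ ?_
    exact rtg_mono (hd.rtg_del hn.1) fun c d h => ⟨h.1, fun h' => h.2.1 h'.1, fun h' => h.2.2 h'.2⟩

theorem TwoVDP.rtg_del {E : V → V → Prop} {x y z : V} (h : TwoVDP E x y) (hx : x ≠ z)
    (hy : y ≠ z) : Relation.ReflTransGen (DelVertex E z) x y := by
  obtain ⟨p, q, hp, hq, -, hd⟩ := h
  by_cases hzp : z ∈ p
  · by_cases hzq : z ∈ q
    · rcases hd z hzp hzq with h | h
      · exact absurd h.symm hx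
      · exact absurd h.symm hy
    · exact hq.rtg_del hzq
  · exact hp.rtg_del hzp

theorem TwoVDP.rtg_edge {E : V → V → Prop} {x y s t : V} (h : TwoVDP E x y) (hxy : x ≠ y)
    (hst : s ≠ t) : Relation.ReflTransGen (fun a b => E a b ∧ ¬ (a = s ∧ b = t)) x y := by
  by_cases hs : x ≠ s ∧ y ≠ s
  · exact rtg_mono (h.rtg_del hs.1 hs.2) fun c d h => ⟨h.1, fun h' => h.2.1 h'.1⟩
  by_cases ht : x ≠ t ∧ y ≠ t
  · exact rtg_mono (h.rtg_del ht.1 ht.2) fun c d h => ⟨h.1, fun h' => h.2.2 h'.2⟩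
  have key : Relation.ReflTransGen
      (fun a b => E a b ∧ ¬ (a = x ∧ b = y) ∧ ¬ (a = y ∧ b = x)) x y := by
    obtain ⟨p, q, hp, hq, hpq, -⟩ := h
    by_cases hp' : p = [x, y]
    · exact hq.rtg_edge hxy fun h => hpq (hp'.trans h.symm)
    · exact hp.rtg_edge hxy hp'
  refine rtg_mono key ?_
  rintro c d ⟨h1, h2, h3⟩
  refine ⟨h1, ?_⟩
  rintro ⟨rfl, rfl⟩
  grind

theorem Rel2d.symm {E : V → V → Prop} {x y : V} (h : Rel2d E x y) : Rel2d E y x :=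
  ⟨h.1.symm, h.2.2, h.2.1⟩

theorem rtg_lift {r s : V → V → Prop} (h : ∀ a b, r a b → Relation.ReflTransGen s a b) {x y : V}
    (hxy : Relation.ReflTransGen r x y) : Relation.ReflTransGen s x y := by
  induction hxy with
  | refl => exact .refl
  | tail _ hbc ih => exact ih.trans (h _ _ hbc)

theorem twoVDP_closure {E : V → V → Prop} {x y : V} (hxy : x ≠ y)
    (hcut : ∀ z, z ≠ x → z ≠ y → Relation.ReflTransGen (DelVertex (Rel2d E) z) x y)
    (hr : Relation.ReflTransGen (Rel2d E) x y) : TwoVDP E x y := by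
  refine twoVDP_of_cut hxy (fun z hx hy => ?_) ?_
  · exact rtg_lift (fun a b h => h.1.2.1.rtg_del h.2.1 h.2.2) (hcut z hx hy)
  · exact rtg_lift (fun a b h => h.2.1.rtg_edge h.1 hxy) hr

theorem rtg_symm {r : V → V → Prop} (hs : ∀ a b, r a b → r b a) {x y : V}
    (h : Relation.ReflTransGen r x y) : Relation.ReflTransGen r y x := by
  induction h with
  | refl => exact .refl
  | tail _ hbc ih => exact .head (hs _ _ hbc) ih

theorem rel2d_closure {E : V → V → Prop} {x y : V} (hxy : x ≠ y)
    (hcut : ∀ z, z ≠ x → z ≠ y → Relation.ReflTransGen (DelVertex (Rel2d E) z) x y)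
    (hr : Relation.ReflTransGen (Rel2d E) x y) : Rel2d E x y :=
  ⟨hxy, twoVDP_closure hxy hcut hr, twoVDP_closure hxy.symm
    (fun z h1 h2 => rtg_symm (fun _ _ h => ⟨h.1.symm, h.2.2, h.2.1⟩) (hcut z h2 h1))
    (rtg_symm (fun _ _ h => h.symm) hr)⟩

/-- The vertices of `G` represented by a node of the block graph. -/
def nodeSet : Set V ⊕ V → Set V
  | .inl C => C
  | .inr v => {v}

theorem block_rtg {E : V → V → Prop} {C : Set V} (hC : IsMaxBlock (Rel2d E) 2 C) {c d w : V}
    (hc : c ∈ C) (hd : d ∈ C) (hcw : c ≠ w) (hdw : d ≠ w) :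
    Relation.ReflTransGen (DelVertex (Rel2d E) w) c d := by
  by_cases h : c = d
  · rw [h]
  · exact .single ⟨hC.2.1 c hc d hd h, hcw, hdw⟩

theorem walk_rtg {E : V → V → Prop} {w : V} {a : Set V ⊕ V} {C : Set V}
    (hC : IsMaxBlock (Rel2d E) 2 C) (p : (blockGraph E).Walk a (.inl C))
    (hp : Sum.inr w ∉ p.support) (c d : V) (hc : c ∈ nodeSet a) (hd : d ∈ C) (hcw : c ≠ w)
    (hdw : d ≠ w) : Relation.ReflTransGen (DelVertex (Rel2d E) w) c d := by
  generalize hb : (Sum.inl C : Set V ⊕ V) = b at p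
  induction p generalizing c with
  | nil =>
    subst hb
    exact block_rtg hC hc hd hcw hdw
  | @cons a a' b hadj p ih =>
    subst hb
    simp only [SimpleGraph.Walk.support_cons, List.mem_cons, not_or] at hp
    rw [blockGraph, SimpleGraph.fromRel_adj] at hadj
    rcases hadj.2 with ⟨D, v, rfl, rfl, hD, hv, -⟩ | ⟨D, v, rfl, rfl, hD, hv, -⟩
    · have hvw : v ≠ w := by
        rintro rfl
        exact hp.2 p.start_mem_support
      exact (block_rtg hD hc hv hcw hvw).trans (ih v rfl hvw rfl hp.2)
    · have : c = v := hc
      subst this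
      exact ih c hv hcw rfl hp.2

theorem block_eq {E : V → V → Prop} {w : V} {C D : Set V}
    (hC : IsMaxBlock (Rel2d E) 2 C) (hD : IsMaxBlock (Rel2d E) 2 D) (hwC : w ∈ C) (hwD : w ∈ D)
    (p : (blockGraph E).Walk (.inl D) (.inl C)) (hp : Sum.inr w ∉ p.support) : D = C := by
  have toH : ∀ {c d : V}, c ≠ d → Rel2d E c d → Relation.ReflTransGen (Rel2d E) c d :=
    fun _ h => .single h
  have key : ∀ d ∈ D, ∀ c ∈ C, d ≠ c → Rel2d E d c := by
    intro d hd c hc hdc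
    refine rel2d_closure hdc (fun z hzd hzc => ?_) ?_
    · by_cases hzw : z = w
      · subst hzw
        exact walk_rtg hC p hp d c hd hc hzd.symm hzc.symm
      · exact (block_rtg hD hd hwD hzd.symm (Ne.symm hzw)).trans
          (block_rtg hC hwC hc (Ne.symm hzw) hzc.symm)
    · refine Relation.ReflTransGen.trans (b := w) ?_ ?_
      · by_cases h : d = w
        · rw [h]
        · exact .single (hD.2.1 d hd w hwD h)
      · by_cases h : w = c
        · rw [h]
        · exact .single (hC.2.1 w hwC c hc h)
  have hU : ∀ x ∈ D ∪ C, ∀ y ∈ D ∪ C, x ≠ y → Rel2d E x y := by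
    rintro x (hx | hx) y (hy | hy) hxy
    · exact hD.2.1 x hx y hy hxy
    · exact key x hx y hy hxy
    · exact (key y hy x hx hxy.symm).symm
    · exact hC.2.1 x hx y hy hxy
  exact (hD.2.2 _ Set.subset_union_left hU).symm.trans (hC.2.2 _ Set.subset_union_right hU)

theorem blockGraph_bridge {E : V → V → Prop} {C : Set V} {w : V}
    (hC : IsMaxBlock (Rel2d E) 2 C) (hwC : w ∈ C) :
    (blockGraph E).IsBridge s(Sum.inr w, Sum.inl C) := by
  classical
  rw [SimpleGraph.isBridge_iff]
  rintro ⟨q⟩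
  obtain ⟨r, hq⟩ := q.toPath
  cases r with
  | @cons _ b _ hadj p =>
    rw [SimpleGraph.Walk.cons_isPath_iff] at hq
    rw [SimpleGraph.deleteEdges_adj] at hadj
    obtain ⟨hadj, hne⟩ := hadj
    rw [blockGraph, SimpleGraph.fromRel_adj] at hadj
    rcases hadj.2 with ⟨D, v, h, -⟩ | ⟨D, v, rfl, h, hD, hv, -⟩
    · cases h
    · cases h
      have hle : ((blockGraph E).deleteEdges {s(Sum.inr w, Sum.inl C)}) ≤ blockGraph E :=
        SimpleGraph.deleteEdges_le _
      have := block_eq hC hD hwC hv (p.mapLe hle) (by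
        simpa using hq.2)
      subst this
      exact hne rfl

/-- Lemma 5: the 2-directed block graph of a strongly connected
finite simple digraph is a forest. -/
theorem stmt4 {V : Type*} [Fintype V] (E : V → V → Prop)
    (hirr : ∀ v, ¬ E v v) (hsc : IsStronglyConn E) :
    (blockGraph E).IsAcyclic := by
  rw [SimpleGraph.isAcyclic_iff_forall_adj_isBridge]
  intro a b hab
  rw [blockGraph, SimpleGraph.fromRel_adj] at hab
  rcases hab.2 with ⟨D, v, rfl, rfl, hD, hv, -⟩ | ⟨D, v, rfl, rfl, hD, hv, -⟩
  · rw [Sym2.eq_swap]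
    exact blockGraph_bridge hD hv
  · exact blockGraph_bridge hD hv
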